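/- Let K be a complete discretely valued field with valuation v, and D = H(a,b) a quaternion division algebra over K in which a and b are units (v(a) = v(b) = 0). If α = x1 + x2 i + x3 j + x4 k ∈ D has v(nr(α)) ≥ 0, then there exists r ≥ 0 depending only on D (not on α) such that v(x_m) ≥ -r for m = 1,2,3,4; moreover if the valuation ring A of D (elements α with v(nr(α)) ≥ 0) satisfies π^r·A ⊆ O + O·i + O·j + O·k for the valuation ring O of K and uniformizer π, then v(π^r·x1) ≥ 0. -/

import Mathlib

open Quaternion

open Filter Topology

/-- In a valued ring with values in `ℝ≥0`, a sequence whose valuations tend to `0` tends to `0`. -/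
theorem Valued.tendsto_zero_of_tendsto_v {R ι : Type*} [Ring R] [Valued R NNReal]
    {l : Filter ι} {f : ι → R} (hf : Tendsto (fun n => Valued.v (f n)) l (𝓝 0)) :
    Tendsto f l (𝓝 0) := by
  rw [(Valued.hasBasis_nhds_zero R NNReal).tendsto_right_iff]
  intro γ _
  have hγ : 0 < MonoidWithZeroHom.ValueGroup₀.embedding γ.1 :=
    pos_iff_ne_zero.mpr ((map_ne_zero _).mpr γ.ne_zero)
  filter_upwards [hf.eventually_lt_const hγ] with n hn
  exact (Valuation.restrict_lt_iff_lt_embedding _).mpr hn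

/-- The additive group of a valued ring is nonarchimedean. -/
theorem Valued.nonarchimedeanAddGroup (R : Type*) {Γ₀ : Type*} [Ring R]
    [LinearOrderedCommGroupWithZero Γ₀] [Valued R Γ₀] :
    NonarchimedeanAddGroup R where
  is_nonarchimedean U hU := by
    obtain ⟨γ, hγ⟩ := Valued.mem_nhds_zero.mp hU
    exact ⟨⟨Valued.v.restrict.ltAddSubgroup γ, Valued.isOpen_ball R γ.1⟩, hγ⟩

/-- Over a complete valued field, `X ^ 2 - X + c` has a root as soon as `v c < 1`. -/
theorem Valued.exists_sq_add_eq_self {K : Type*} [Field K] [Valued K NNReal] [CompleteSpace K]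
    {c : K} (hc : Valued.v c < 1) : ∃ s : K, s ^ 2 + c = s := by
  let u : ℕ → K := fun n => (fun s => s ^ 2 + c)^[n] 0
  have hu : ∀ n, u (n + 1) = u n ^ 2 + c := fun n => Function.iterate_succ_apply' _ n 0
  have hle : ∀ n, Valued.v (u n) ≤ Valued.v c := by
    intro n
    induction n with
    | zero => simp [u]
    | succ n ih =>
      rw [hu]
      refine Valuation.map_add_le _ ?_ le_rfl
      rw [map_pow, sq]
      exact (mul_le_of_le_one_right' (ih.trans hc.le)).trans ih
  have hdiff : ∀ n, Valued.v (u (n + 1) - u n) ≤ Valued.v c ^ (n + 1) := by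
    intro n
    induction n with
    | zero => simp [u]
    | succ n ih =>
      have h : u (n + 1 + 1) - u (n + 1) = (u (n + 1) - u n) * (u (n + 1) + u n) := by
        rw [hu (n + 1), hu n]; ring
      rw [h, map_mul, pow_succ]
      exact mul_le_mul' ih (Valuation.map_add_le _ (hle _) (hle _))
  have hlim : Tendsto (fun n => u (n + 1) - u n) atTop (𝓝 0) := by
    apply Valued.tendsto_zero_of_tendsto_v
    exact tendsto_of_tendsto_of_tendsto_of_le_of_le tendsto_const_nhds
      ((tendsto_add_atTop_iff_nat 1).mpr (tendsto_pow_atTop_nhds_zero_of_lt_one zero_le hc))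
      (fun _ => zero_le) hdiff
  have := Valued.nonarchimedeanAddGroup K
  obtain ⟨s, hs⟩ := cauchySeq_tendsto_of_complete
    (NonarchimedeanAddGroup.cauchySeq_of_tendsto_sub_nhds_zero hlim)
  refine ⟨s, tendsto_nhds_unique ((hs.pow 2).add_const c) ?_⟩
  simpa only [hu] using (tendsto_add_atTop_iff_nat 1).mpr hs

/-- In a quaternion division algebra over a complete valued field, an element of integral
reduced norm has integral reduced trace. -/
theorem QuaternionAlgebra.v_two_mul_re_le_one {K : Type*} [Field K] [Valued K NNReal]
    [CompleteSpace K] {a b : K} (hdiv : ∀ α : ℍ[K, a, b], α ≠ 0 → IsUnit α) (α : ℍ[K, a, b])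
    (hα : Valued.v ((α * star α).re) ≤ 1) : Valued.v (2 * α.re) ≤ 1 := by
  by_contra! ht
  have ht0 : 2 * α.re ≠ 0 := by
    intro h
    simp [h] at ht
  obtain ⟨s, hs⟩ := Valued.exists_sq_add_eq_self
    (c := (α * star α).re / (2 * α.re) ^ 2) (by
      rw [map_div₀, map_pow]
      exact (div_lt_one (by positivity)).mpr (hα.trans_lt (one_lt_pow₀ ht two_ne_zero)))
  let β : ℍ[K, a, b] := α - ((2 * α.re * s : K) : ℍ[K, a, b])
  have hβ : β * star β = 0 := by
    rw [QuaternionAlgebra.mul_star_eq_coe]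
    have : (β * star β).re = 0 := by
      have h : (2 * α.re) ^ 2 * s ^ 2 + (α * star α).re = (2 * α.re) ^ 2 * s := by
        rw [← mul_div_cancel₀ (α * star α).re (pow_ne_zero 2 ht0)]
        linear_combination (2 * α.re) ^ 2 * hs
      simp only [QuaternionAlgebra.re_mul, QuaternionAlgebra.re_star, QuaternionAlgebra.imI_star,
        QuaternionAlgebra.imJ_star, QuaternionAlgebra.imK_star] at h
      simp [β]
      linear_combination h
    rw [this, QuaternionAlgebra.coe_zero]
  have hβ0 : β = 0 := by
    by_contra h
    exact h (star_eq_zero.mp (((hdiv β h).mul_right_eq_zero).mp hβ))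
  have hαs : α = ((2 * α.re * s : K) : ℍ[K, a, b]) := sub_eq_zero.mp hβ0
  have hn : (α * star α).re = α.re ^ 2 := by
    have := QuaternionAlgebra.eq_re_of_eq_coe hαs
    rw [this]
    simp [sq]
  rw [hn, map_pow] at hα
  have h2 : Valued.v (2 : K) ≤ 1 := by
    rw [← one_add_one_eq_two]
    exact Valuation.map_add_le _ (map_one _).le (map_one _).le
  rw [map_mul] at ht
  exact ht.not_ge (mul_le_one' h2 ((pow_le_one_iff two_ne_zero).mp hα))

/-- Let `K` be a complete discretely valued field with uniformizer `π`, and let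
`D = H(a,b)` be a quaternion division algebra over `K` with `a, b` units
(`v a = v b = 1`).  Then there is an `r ≥ 0`, depending only on `D`, such that every
`α = x₁ + x₂ i + x₃ j + x₄ k` with integral reduced norm (`v(nr α) ≤ 1`) has all
coordinates of valuation ≥ `-r`, i.e. `v(π^r · x_m) ≤ 1` for `m = 1,2,3,4`; in
particular `v(π^r · x₁) ≤ 1`. -/
theorem quaternion_order_coordinates_bounded
    (K : Type*) [Field K] [hv : Valued K NNReal] [CompleteSpace K]
    (π : K) (hπ0 : Valued.v π ≠ 0) (hπ1 : Valued.v π < 1)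
    (hdisc : ∀ x : K, x ≠ 0 → ∃ n : ℤ, Valued.v x = Valued.v π ^ n)
    (h2 : (2 : K) ≠ 0) (a b : K)
    (hua : Valued.v a = 1) (hub : Valued.v b = 1)
    (hdiv : ∀ α : ℍ[K, a, b], α ≠ 0 → IsUnit α) :
    ∃ r : ℕ, ∀ α : ℍ[K, a, b], Valued.v ((α * star α).re) ≤ 1 →
      Valued.v (π ^ r * α.re) ≤ 1 ∧ Valued.v (π ^ r * α.imI) ≤ 1 ∧
      Valued.v (π ^ r * α.imJ) ≤ 1 ∧ Valued.v (π ^ r * α.imK) ≤ 1 := by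
  obtain ⟨r, hr⟩ := exists_pow_lt_of_lt_one
    (pos_iff_ne_zero.mpr ((Valuation.ne_zero_iff _).mpr h2 : Valued.v (2 : K) ≠ 0)) hπ1
  have key : ∀ x : K, Valued.v (2 * x) ≤ 1 → Valued.v (π ^ r * x) ≤ 1 := by
    intro x hx
    rw [map_mul] at hx ⊢
    rw [map_pow]
    exact (mul_le_mul_left hr.le _).trans hx
  refine ⟨r, fun α hα => ?_⟩
  have htr := QuaternionAlgebra.v_two_mul_re_le_one hdiv
  refine ⟨key _ (htr α hα), key _ ?_, key _ ?_, key _ ?_⟩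
  · have h := htr (α * ⟨0, 1, 0, 0⟩) (by
      have : ((α * ⟨0, 1, 0, 0⟩) * star (α * ⟨0, 1, 0, 0⟩)).re = -a * (α * star α).re := by
        simp; ring
      rw [this, map_mul, Valuation.map_neg, hua, one_mul]; exact hα)
    have e : (α * ⟨0, 1, 0, 0⟩).re = a * α.imI := by simp
    rwa [e, mul_left_comm, map_mul, hua, one_mul] at h
  · have h := htr (α * ⟨0, 0, 1, 0⟩) (by
      have : ((α * ⟨0, 0, 1, 0⟩) * star (α * ⟨0, 0, 1, 0⟩)).re = -b * (α * star α).re := by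
        simp; ring
      rw [this, map_mul, Valuation.map_neg, hub, one_mul]; exact hα)
    have e : (α * ⟨0, 0, 1, 0⟩).re = b * α.imJ := by simp
    rwa [e, mul_left_comm, map_mul, hub, one_mul] at h
  · have h := htr (α * ⟨0, 0, 0, 1⟩) (by
      have : ((α * ⟨0, 0, 0, 1⟩) * star (α * ⟨0, 0, 0, 1⟩)).re = a * b * (α * star α).re := by
        simp; ring
      rw [this, map_mul, map_mul, hua, hub, one_mul, one_mul]; exact hα)
    have e : (α * ⟨0, 0, 0, 1⟩).re = -(a * b) * α.imK := by simp
    rwa [e, mul_left_comm, map_mul, Valuation.map_neg, map_mul, hua, hub, one_mul, one_mul] at h
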